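/- arXiv:1912.01261 — 2 statements merged into one kernel-verified Lean document; each statement's English description precedes it below -/
import Mathlib

section
/- Suppose f is (α,β)-regular with α > 0, let T(x) = argmin_{x'∈X} f_x(x'), and let (x_{n_k}) be a subsequence in X with ‖x_{n_k} − T(x_{n_k})‖ → 0 and x_{n_k} → x̄ ∈ X. Then x̄ is a fixed point of T, i.e. f_{x̄}(x̄) = min_{x∈X} f_{x̄}(x), so x̄ is an equilibrium of the COL problem. -/
open RealInnerProductSpace Filter

/-- The difference quotients of `φ` at `a` along `v` converge to the inner product of the gradient
with `v`. -/
theorem HasGradientAt.tendsto_slope_inner {E : Type*} [NormedAddCommGroup E]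
    [InnerProductSpace ℝ E] [CompleteSpace E] {φ : E → ℝ} {g a : E}
    (h : HasGradientAt φ g a) (v : E) :
    Tendsto (fun t : ℝ => t⁻¹ * (φ (a + t • v) - φ a)) (nhdsWithin 0 (Set.Ioi 0))
      (nhds ⟪g, v⟫) := by
  have hl : HasLineDerivAt ℝ φ ⟪g, v⟫ a v := by
    simpa using h.hasFDerivAt.hasLineDerivAt v
  simpa using hl.tendsto_slope_zero_right

/-- Quadratic lower bound of a strongly convex function by its first-order expansion. -/
theorem StrongConvexOn.add_inner_add_sq_le {E : Type*} [NormedAddCommGroup E]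
    [InnerProductSpace ℝ E] [CompleteSpace E] {X : Set E} {φ : E → ℝ} {m : ℝ} {g a b : E}
    (hφ : StrongConvexOn X m φ) (ha : a ∈ X) (hb : b ∈ X) (h : HasGradientAt φ g a) :
    φ a + ⟪g, b - a⟫ + m / 2 * ‖b - a‖ ^ 2 ≤ φ b := by
  have hlim : Tendsto (fun t : ℝ => φ b - φ a - (1 - t) * (m / 2 * ‖b - a‖ ^ 2))
      (nhdsWithin 0 (Set.Ioi 0)) (nhds (φ b - φ a - (1 - 0) * (m / 2 * ‖b - a‖ ^ 2))) :=
    (Continuous.tendsto (by fun_prop) 0).mono_left nhdsWithin_le_nhds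
  have hle := le_of_tendsto_of_tendsto (h.tendsto_slope_inner (b - a)) hlim (by
    filter_upwards [Ioo_mem_nhdsGT (zero_lt_one' ℝ)] with t ⟨ht0, ht1⟩
    have hc := hφ.2 ha hb (sub_nonneg.2 ht1.le) ht0.le (sub_add_cancel 1 t)
    rw [show (1 - t) • a + t • b = a + t • (b - a) by module, norm_sub_rev] at hc
    simp only [smul_eq_mul] at hc
    rw [inv_mul_le_iff₀ ht0]
    linarith)
  linarith

/-- First-order optimality condition for a minimizer over a convex set. -/
theorem IsMinOn.inner_gradient_nonneg {E : Type*} [NormedAddCommGroup E]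
    [InnerProductSpace ℝ E] [CompleteSpace E] {X : Set E} {φ : E → ℝ} {g a b : E}
    (hX : Convex ℝ X) (hmin : IsMinOn φ X a) (ha : a ∈ X) (hb : b ∈ X)
    (h : HasGradientAt φ g a) : 0 ≤ ⟪g, b - a⟫ := by
  refine ge_of_tendsto (h.tendsto_slope_inner (b - a)) ?_
  filter_upwards [Ioo_mem_nhdsGT (zero_lt_one' ℝ)] with t ⟨ht0, ht1⟩
  exact mul_nonneg (inv_nonneg.2 ht0.le)
    (sub_nonneg.2 (hmin (hX.add_smul_sub_mem ha hb ⟨ht0.le, ht1.le⟩)))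

/-- Minimizers over a convex set depend on the loss in a Lipschitz way: if `φ` is strongly convex,
the distance of the minimizers of `φ` and `ψ` is controlled by the gap of their gradients. -/
theorem StrongConvexOn.norm_sub_minimizer_le {E : Type*} [NormedAddCommGroup E]
    [InnerProductSpace ℝ E] [CompleteSpace E] {X : Set E} {φ ψ : E → ℝ} {m : ℝ} {p q u v : E}
    (hφ : StrongConvexOn X m φ) (hu : u ∈ X) (hv : v ∈ X)
    (hp : HasGradientAt φ p u) (hq : HasGradientAt ψ q u)
    (hφv : IsMinOn φ X v) (hψu : IsMinOn ψ X u) :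
    m / 2 * ‖v - u‖ ≤ ‖q - p‖ := by
  have h1 := hφ.add_inner_add_sq_le hu hv hp
  have h2 := hψu.inner_gradient_nonneg hφ.1 hu hv hq
  have h3 : φ v ≤ φ u := hφv hu
  have h4 := real_inner_le_norm (q - p) (v - u)
  rw [inner_sub_left] at h4
  rcases (norm_nonneg (v - u)).eq_or_lt with h0 | h0
  · rw [← h0, mul_zero]
    exact norm_nonneg _
  · refine le_of_mul_le_mul_right ?_ h0
    linarith

/-- For an `(α,β)`-regular `f` with `α > 0` and argmin map `T`, if a subsequence `(x_{n_k})`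
in `X` satisfies `‖x_{n_k} − T(x_{n_k})‖ → 0` and `x_{n_k} → x̄ ∈ X`, then `x̄` is a fixed
point of `T`, i.e. an equilibrium: `f_{x̄}(x̄) = min_{x∈X} f_{x̄}(x)`. -/
theorem stmt_8
    {E : Type*} [NormedAddCommGroup E] [InnerProductSpace ℝ E] [FiniteDimensional ℝ E]
    (X : Set E) (hXne : X.Nonempty) (hXcp : IsCompact X) (hXcv : Convex ℝ X)
    (f : E → E → ℝ) (f' : E → E → E) (α β : ℝ) (hα : 0 < α)
    (hgrad : ∀ x ∈ X, ∀ x' ∈ X, HasGradientAt (f x) (f' x x') x')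
    (hsc : ∀ x ∈ X, StrongConvexOn X α (f x))
    (hlip : ∀ x' ∈ X, ∀ x ∈ X, ∀ y ∈ X, ‖f' x x' - f' y x'‖ ≤ β * ‖x - y‖)
    -- `T` is the argmin map
    (T : E → E) (hT : ∀ x ∈ X, T x ∈ X ∧ IsMinOn (f x) X (T x))
    -- the subsequence `(x_{n_k})`
    (x : ℕ → E) (n : ℕ → ℕ) (hn : StrictMono n) (hx : ∀ k, x (n k) ∈ X)
    (xbar : E) (hxbar : xbar ∈ X)
    (hgap : Tendsto (fun k => ‖x (n k) - T (x (n k))‖) atTop (nhds 0))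
    (hconv : Tendsto (fun k => x (n k)) atTop (nhds xbar)) :
    T xbar = xbar ∧ IsMinOn (f xbar) X xbar := by
  obtain ⟨hTX, hTmin⟩ := hT xbar hxbar
  have hTx : Tendsto (fun k => T (x (n k))) atTop (nhds xbar) := by
    simpa using hconv.sub (tendsto_zero_iff_norm_tendsto_zero.2 hgap)
  have hbound : ∀ k, α / 2 * ‖T xbar - T (x (n k))‖ ≤ β * ‖x (n k) - xbar‖ := fun k => by
    obtain ⟨hkX, hkmin⟩ := hT _ (hx k)
    exact ((hsc xbar hxbar).norm_sub_minimizer_le hkX hTX (hgrad _ hxbar _ hkX)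
      (hgrad _ (hx k) _ hkX) hTmin hkmin).trans (hlip _ hkX _ (hx k) _ hxbar)
  have hle := le_of_tendsto_of_tendsto' ((hTx.const_sub (T xbar)).norm.const_mul (α / 2))
    ((hconv.sub_const xbar).norm.const_mul β) hbound
  rw [sub_self, norm_zero, mul_zero] at hle
  have hfix : T xbar = xbar :=
    sub_eq_zero.1 (norm_le_zero_iff.1 (nonpos_of_mul_nonpos_right hle (half_pos hα)))
  rw [hfix] at hTmin
  exact ⟨hfix, hTmin⟩
end

section
/- (Reduction of dynamic regret) Suppose f is (α,β)-regular with α > 0, ‖∇f_x(x)‖ ≤ G for all x ∈ X, and x* ∈ X solves the variational inequality ⟨∇f_{x*}(x*), x − x*⟩ ≥ 0 for all x ∈ X. For any sequence (x_n) in X set Δ_n = ‖x_n − x*‖. Then for all N: Regret^d_N ≤ min{ G·∑_{n=1}^N Δ_n , Regret^s_N(x*) } + ∑_{n=1}^N min{ β·D_X·Δ_n , (β²/(2α))·Δ_n² }, where D_X = max_{x,x'∈X} ‖x−x'‖. -/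
open RealInnerProductSpace

open Topology in
/-- First-order lower bound for a strongly convex function. -/
theorem StrongConvexOn.add_inner_gradient_le
    {E : Type*} [NormedAddCommGroup E] [InnerProductSpace ℝ E] [CompleteSpace E]
    {s : Set E} {m : ℝ} {f : E → ℝ} {g x y : E} (hf : StrongConvexOn s m f)
    (hg : HasGradientAt f g x) (hx : x ∈ s) (hy : y ∈ s) :
    f x + ⟪g, y - x⟫ + m / 2 * ‖y - x‖ ^ 2 ≤ f y := by
  have hline : HasDerivAt (fun t : ℝ => x + t • (y - x)) (y - x) 0 := by
    simpa using ((hasDerivAt_id (0 : ℝ)).smul_const (y - x)).const_add x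
  have hderiv : HasDerivAt (fun t : ℝ => f (x + t • (y - x))) ⟪g, y - x⟫ 0 := by
    have hg' : HasFDerivAt f (InnerProductSpace.toDual ℝ E g) (x + (0 : ℝ) • (y - x)) := by
      simpa using hg.hasFDerivAt
    simpa [Function.comp_def] using hg'.comp_hasDerivAt (0 : ℝ) hline
  have hlim : Filter.Tendsto (fun t : ℝ => f y - f x - (1 - t) * (m / 2 * ‖y - x‖ ^ 2))
      (𝓝[>] 0) (𝓝 (f y - f x - (1 - 0) * (m / 2 * ‖y - x‖ ^ 2))) :=
    (Continuous.tendsto (by fun_prop) 0).mono_left nhdsWithin_le_nhds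
  have hle := le_of_tendsto_of_tendsto hderiv.tendsto_slope_zero_right hlim (by
    filter_upwards [Ioo_mem_nhdsGT (zero_lt_one' ℝ)] with t ht
    have h := hf.2 hx hy (sub_nonneg.2 ht.2.le) ht.1.le (by ring)
    have hpt : (1 - t) • x + t • y = x + t • (y - x) := by module
    rw [hpt, norm_sub_rev x y] at h
    simp only [smul_eq_mul, zero_add, zero_smul, add_zero] at h ⊢
    rw [inv_mul_le_iff₀ ht.1]
    linarith)
  linarith

/-- Reduction of dynamic regret: if `f` is `(α,β)`-regular with `α > 0`, the gradients are
bounded by `G` on `X`, and `x*` solves the variational inequality for `F(x) = ∇f_x(x)`, then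
`Regret^d_N ≤ min{G·∑Δ_n, Regret^s_N(x*)} + ∑ min{β·D_X·Δ_n, (β²/(2α))·Δ_n²}` where
`Δ_n = ‖x_n − x*‖` and `D_X` is the diameter of `X`. -/
theorem stmt_11
    {E : Type*} [NormedAddCommGroup E] [InnerProductSpace ℝ E] [FiniteDimensional ℝ E]
    (X : Set E) (hXne : X.Nonempty) (hXcp : IsCompact X) (hXcv : Convex ℝ X)
    (f : E → E → ℝ) (f' : E → E → E) (α β G : ℝ) (hα : 0 < α) (hβ : 0 ≤ β)
    (hgrad : ∀ x ∈ X, ∀ x' ∈ X, HasGradientAt (f x) (f' x x') x')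
    (hsc : ∀ x ∈ X, StrongConvexOn X α (f x))
    (hlip : ∀ x' ∈ X, ∀ x ∈ X, ∀ y ∈ X, ‖f' x x' - f' y x'‖ ≤ β * ‖x - y‖)
    (hG : ∀ x ∈ X, ‖f' x x‖ ≤ G)
    (xs : E) (hxs : xs ∈ X)
    (hVI : ∀ x ∈ X, ⟪f' xs xs, x - xs⟫ ≥ 0)
    (x : ℕ → E) (hx : ∀ n, x n ∈ X) :
    ∀ N : ℕ,
      ∑ n ∈ Finset.Icc 1 N, (f (x n) (x n) - sInf (f (x n) '' X)) ≤
        min (G * ∑ n ∈ Finset.Icc 1 N, ‖x n - xs‖)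
            (∑ n ∈ Finset.Icc 1 N, (f (x n) (x n) - f (x n) xs)) +
        ∑ n ∈ Finset.Icc 1 N,
          min (β * Metric.diam X * ‖x n - xs‖) (β ^ 2 / (2 * α) * ‖x n - xs‖ ^ 2) := by
  intro N
  have hfirst : ∀ n, f (x n) (x n) - f (x n) xs ≤ G * ‖x n - xs‖ := fun n => by
    have h := (hsc _ (hx n)).add_inner_gradient_le (hgrad _ (hx n) _ (hx n)) (hx n) hxs
    have hin := (abs_le.1 (abs_real_inner_le_norm (f' (x n) (x n)) (xs - x n))).1
    have hmul := mul_le_mul_of_nonneg_right (hG _ (hx n)) (norm_nonneg (xs - x n))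
    have hsq : 0 ≤ α / 2 * ‖xs - x n‖ ^ 2 := by positivity
    rw [norm_sub_rev (x n) xs]
    linarith
  have hsecond : ∀ n, f (x n) xs - sInf (f (x n) '' X) ≤
      min (β * Metric.diam X * ‖x n - xs‖) (β ^ 2 / (2 * α) * ‖x n - xs‖ ^ 2) := fun n => by
    rw [sub_le_comm]
    refine le_csInf (hXne.image _) ?_
    rintro _ ⟨y, hy, rfl⟩
    rw [sub_le_comm]
    have h := (hsc _ (hx n)).add_inner_gradient_le (hgrad _ (hx n) _ hxs) hxs hy
    have hin := (abs_le.1 (abs_real_inner_le_norm (f' (x n) xs - f' xs xs) (y - xs))).1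
    rw [inner_sub_left] at hin
    have hmul := mul_le_mul_of_nonneg_right (hlip xs hxs _ (hx n) _ hxs) (norm_nonneg (y - xs))
    have hvi := hVI y hy
    have hsq : 0 ≤ α / 2 * ‖y - xs‖ ^ 2 := by positivity
    have hmain : f (x n) xs - f (x n) y ≤
        β * ‖x n - xs‖ * ‖y - xs‖ - α / 2 * ‖y - xs‖ ^ 2 := by linarith
    refine le_min ?_ ?_
    · have hdiam : ‖y - xs‖ ≤ Metric.diam X := by
        rw [← dist_eq_norm]
        exact Metric.dist_le_diam_of_mem hXcp.isBounded hy hxs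
      have := mul_le_mul_of_nonneg_left hdiam (mul_nonneg hβ (norm_nonneg (x n - xs)))
      linarith
    · refine hmain.trans (sub_nonneg.1 ?_)
      have hsquare : β ^ 2 / (2 * α) * ‖x n - xs‖ ^ 2 -
          (β * ‖x n - xs‖ * ‖y - xs‖ - α / 2 * ‖y - xs‖ ^ 2) =
          (β * ‖x n - xs‖ - α * ‖y - xs‖) ^ 2 / (2 * α) := by
        field_simp
        ring
      rw [hsquare]
      positivity
  have hsplit : ∑ n ∈ Finset.Icc 1 N, (f (x n) (x n) - sInf (f (x n) '' X)) =
      ∑ n ∈ Finset.Icc 1 N, (f (x n) (x n) - f (x n) xs) +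
        ∑ n ∈ Finset.Icc 1 N, (f (x n) xs - sInf (f (x n) '' X)) := by
    rw [← Finset.sum_add_distrib]
    exact Finset.sum_congr rfl fun n _ => by ring
  rw [hsplit]
  refine add_le_add (le_min ?_ le_rfl) (Finset.sum_le_sum fun n _ => hsecond n)
  rw [Finset.mul_sum]
  exact Finset.sum_le_sum fun n _ => hfirst n
end
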